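/- arXiv:2406.16656 — 4 statements merged into one kernel-verified Lean document; each statement's English description precedes it below -/
import Mathlib

section
/- A permutation code C ⊆ S_n is capable of correcting t deletions (i.e., the deletion balls D_t(π) are pairwise disjoint for distinct codewords) if and only if d_U(π,σ) > t for all distinct π, σ ∈ C. -/
open scoped Classical

/-- A translocation: move the symbol at (0-indexed) position `i` to position `j`,
shifting intermediate symbols by one position. -/
def translocate {α : Type*} (l : List α) (i j : ℕ) : List α :=
  match l[i]? with
  | some a => (l.eraseIdx i).insertIdx j a
  | none => l

/-- The Ulam distance between two sequences: the minimum number of translocations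
needed to transform `x` into `y`. -/
noncomputable def ulamDist {α : Type*} (x y : List α) : ℕ :=
  sInf {m | ∃ g : ℕ → List α, g 0 = x ∧ g m = y ∧
    ∀ k < m, ∃ i j, i < (g k).length ∧ j < (g k).length ∧ i ≠ j ∧
      g (k+1) = translocate (g k) i j}

/-- The sequence form of a permutation of `{1,...,n}` (values written `1`-indexed). -/
def seqOf {n : ℕ} (π : Equiv.Perm (Fin n)) : List ℕ :=
  List.ofFn fun i => (π i : ℕ) + 1

/-- The Ulam distance between two permutations. -/
noncomputable def dU {n : ℕ} (π σ : Equiv.Perm (Fin n)) : ℕ :=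
  ulamDist (seqOf π) (seqOf σ)

/-- Length of a longest common subsequence of two sequences. -/
noncomputable def lcsLen {α : Type*} (x y : List α) : ℕ :=
  sSup {k | ∃ z : List α, z.Sublist x ∧ z.Sublist y ∧ z.length = k}

/-- Levenshtein distance: minimum number of insertions and deletions needed to
transform `x` into `y`. -/
noncomputable def levDist {α : Type*} (x y : List α) : ℕ :=
  sInf {m | ∃ g : ℕ → List α, g 0 = x ∧ g m = y ∧
    ∀ k < m, (∃ i a, i ≤ (g k).length ∧ g (k+1) = (g k).insertIdx i a) ∨
      (∃ i, i < (g k).length ∧ g (k+1) = (g k).eraseIdx i)}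

/-- Hamming distance between two permutations: number of positions where they differ. -/
def dH {m : ℕ} (a b : Equiv.Perm (Fin m)) : ℕ :=
  (Finset.univ.filter fun i => a i ≠ b i).card

/-- `bar π` = the permutation `π` of `{1,...,n}` extended to `{1,...,n+1}` by
appending the symbol `n+1` at the end (i.e. fixing the last point). -/
def bar {n : ℕ} (π : Equiv.Perm (Fin n)) : Equiv.Perm (Fin (n+1)) :=
  (Equiv.permCongr finSuccEquivLast).symm π.optionCongr

/-- The map `f : S_n → S_{n+1}`: `fmap π` sends each symbol `i` to the symbol
that cyclically follows `i` in the sequence form of `bar π`, i.e.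
`f(π̄)_i = π̄_{π̄⁻¹(i)+1}` for `i ≤ n` and `f(π̄)_{n+1} = π̄_1`. -/
def fmap {n : ℕ} (π : Equiv.Perm (Fin n)) : Equiv.Perm (Fin (n+1)) :=
  bar π * finRotate (n+1) * (bar π)⁻¹

/-- The deletion ball `D_t(π)`: all sequences of length `n - t` obtained from `π`
by deleting `t` symbols, i.e. all subsequences of `π` of length `n - t`. -/
def Dball {n : ℕ} (t : ℕ) (π : Equiv.Perm (Fin n)) : Set (List ℕ) :=
  {s | s.Sublist (seqOf π) ∧ s.length = n - t}

/-- `Mnt n t`: the maximum size of a subset of `S_n` whose distinct elements have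
pairwise Ulam distance greater than `t`. -/
noncomputable def Mnt (n t : ℕ) : ℕ :=
  sSup {m | ∃ C : Finset (Equiv.Perm (Fin n)),
    (∀ π ∈ C, ∀ σ ∈ C, π ≠ σ → t < dU π σ) ∧ C.card = m}

section

variable {α : Type*}

/-- `TranslocationPath x y m`: some sequence of exactly `m` translocations turns `x` into `y`. -/
def TranslocationPath (x y : List α) (m : ℕ) : Prop :=
  ∃ g : ℕ → List α, g 0 = x ∧ g m = y ∧
    ∀ k < m, ∃ i j, i < (g k).length ∧ j < (g k).length ∧ i ≠ j ∧
      g (k+1) = translocate (g k) i j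

theorem translocate_append_cons (l₁ l₂ : List α) (a : α) (j : ℕ) :
    translocate (l₁ ++ a :: l₂) l₁.length j = (l₁ ++ l₂).insertIdx j a := by
  simp [translocate, List.eraseIdx_append_of_length_le]

theorem insertIdx_length_append (l₁ l₂ : List α) (a : α) :
    (l₁ ++ l₂).insertIdx l₁.length a = l₁ ++ a :: l₂ := by
  induction l₁ with
  | nil => simp
  | cons b l ih => simp [List.insertIdx_succ_cons, ih]

theorem TranslocationPath.refl (x : List α) : TranslocationPath x x 0 :=
  ⟨fun _ => x, rfl, rfl, by simp⟩

theorem TranslocationPath.cons {x y : List α} {m i j : ℕ} (hi : i < x.length)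
    (hj : j < x.length) (hij : i ≠ j) (h : TranslocationPath (translocate x i j) y m) :
    TranslocationPath x y (m + 1) := by
  obtain ⟨g, h0, hm, hg⟩ := h
  refine ⟨fun k => Nat.casesOn k x g, rfl, hm, ?_⟩
  rintro (_ | k) hk
  · exact ⟨i, j, hi, hj, hij, h0⟩
  · exact hg k (by omega)

/-- A proper sublist of `y` can be enlarged by one symbol of `y`. -/
theorem exists_append_cons_sublist {z y : List α} (h : z.Sublist y)
    (hlt : z.length < y.length) :
    ∃ z₁ z₂ a, z = z₁ ++ z₂ ∧ (z₁ ++ a :: z₂).Sublist y := by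
  induction h with
  | slnil => simp at hlt
  | @cons l₁ l₂ a h _ => exact ⟨[], l₁, a, rfl, h.cons_cons a⟩
  | @cons_cons l₁ l₂ a h ih =>
    obtain ⟨z₁, z₂, b, rfl, hs⟩ := ih (by simpa using hlt)
    exact ⟨a :: z₁, z₂, b, rfl, hs.cons_cons a⟩

theorem sublist_append_of_notMem {z l₁ l₂ : List α} {a : α}
    (h : z.Sublist (l₁ ++ a :: l₂)) (ha : a ∉ z) : z.Sublist (l₁ ++ l₂) := by
  obtain ⟨s, t, rfl, hs, ht⟩ := List.sublist_append_iff.1 h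
  rcases List.sublist_cons_iff.1 ht with ht | ⟨r, rfl, -⟩
  · exact hs.append ht
  · simp at ha

/-- A common subsequence missing at most `d` symbols yields a path of at most `d`
translocations. -/
theorem exists_translocationPath_le {y : List α} (hy : y.Nodup) (d : ℕ) :
    ∀ {x z : List α}, x.Perm y → z.Sublist x → z.Sublist y → y.length ≤ z.length + d →
      ∃ m ≤ d, TranslocationPath x y m := by
  induction d with
  | zero =>
    intro x z hp hx hzy hd
    have hzy' : z = y := hzy.eq_of_length_le hd
    have hxz : z = x := hx.eq_of_length_le (by rw [hp.length_eq]; exact hd)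
    exact ⟨0, le_rfl, hxz ▸ hzy' ▸ TranslocationPath.refl z⟩
  | succ d ih =>
    intro x z hp hx hzy hd
    rcases Nat.lt_or_ge z.length y.length with hlt | hge
    · obtain ⟨z₁, z₂, a, rfl, hs⟩ := exists_append_cons_sublist hzy hlt
      have ha : a ∉ z₁ ++ z₂ :=
        (List.nodup_cons.1 ((List.perm_middle.nodup_iff).1 (hy.sublist hs))).1
      obtain ⟨x₁, x₂, rfl⟩ := List.append_of_mem (hp.mem_iff.2 (hs.subset (by simp) : a ∈ y))
      obtain ⟨w₁, w₂, hw, hw₁, hw₂⟩ :=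
        List.append_sublist_iff.1 (sublist_append_of_notMem hx ha)
      have htr : translocate (x₁ ++ a :: x₂) x₁.length w₁.length = w₁ ++ a :: w₂ := by
        rw [translocate_append_cons, hw, insertIdx_length_append]
      have hperm : (w₁ ++ a :: w₂).Perm (x₁ ++ a :: x₂) :=
        List.perm_middle.trans ((hw ▸ List.Perm.refl _ : (a :: (w₁ ++ w₂)).Perm
          (a :: (x₁ ++ x₂))).trans List.perm_middle.symm)
      obtain ⟨m, hm, hpath⟩ := ih (hperm.trans hp) (hw₁.append (hw₂.cons_cons a)) hs
        (by simp at hd ⊢; omega)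
      by_cases hij : x₁.length = w₁.length
      · obtain ⟨rfl, rfl⟩ := List.append_inj hw hij
        exact ⟨m, by omega, hpath⟩
      · refine ⟨m + 1, by omega, .cons (i := x₁.length) (j := w₁.length) (by simp) ?_ hij
          (htr ▸ hpath)⟩
        have := hperm.length_eq
        simp at this ⊢
        omega
    · obtain ⟨m, hm, h⟩ := ih hp hx hzy (by omega)
      exact ⟨m, by omega, h⟩

theorem exists_sublist_eraseIdx {z l : List α} (h : z.Sublist l) (i : ℕ) :
    ∃ z' : List α, z'.Sublist z ∧ z'.Sublist (l.eraseIdx i) ∧ z.length ≤ z'.length + 1 := by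
  induction h generalizing i with
  | slnil => exact ⟨[], by simp⟩
  | @cons l₁ l₂ a h ih =>
    cases i with
    | zero => exact ⟨l₁, .refl _, by simpa using h, by simp⟩
    | succ i =>
      obtain ⟨z', h₁, h₂, h₃⟩ := ih i
      exact ⟨z', h₁, by simpa using h₂.cons a, h₃⟩
  | @cons_cons l₁ l₂ a h ih =>
    cases i with
    | zero => exact ⟨l₁, List.sublist_cons_self _ _, by simpa using h, by simp⟩
    | succ i =>
      obtain ⟨z', h₁, h₂, h₃⟩ := ih i
      exact ⟨a :: z', h₁.cons_cons a, by simpa using h₂.cons_cons a, by simpa using h₃⟩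

theorem eraseIdx_sublist_translocate {l : List α} {i j : ℕ} (hi : i < l.length) :
    (l.eraseIdx i).Sublist (translocate l i j) := by
  simp only [translocate, List.getElem?_eq_getElem hi]
  exact List.sublist_insertIdx _ _ _

/-- Each translocation shortens a longest common subsequence by at most one. -/
theorem TranslocationPath.exists_sublist {x y : List α} {m : ℕ}
    (h : TranslocationPath x y m) :
    ∃ z : List α, z.Sublist x ∧ z.Sublist y ∧ x.length ≤ z.length + m := by
  obtain ⟨g, rfl, rfl, hg⟩ := h
  suffices H : ∀ k ≤ m, ∃ z : List α, z.Sublist (g 0) ∧ z.Sublist (g k) ∧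
      (g 0).length ≤ z.length + k from H m le_rfl
  intro k
  induction k with
  | zero => exact fun _ => ⟨g 0, .refl _, .refl _, le_rfl⟩
  | succ k ih =>
    intro hk
    obtain ⟨z, hz₀, hzk, hlen⟩ := ih (by omega)
    obtain ⟨i, j, hi, -, -, hstep⟩ := hg k (by omega)
    obtain ⟨z', h₁, h₂, h₃⟩ := exists_sublist_eraseIdx hzk i
    exact ⟨z', h₁.trans hz₀, hstep ▸ h₂.trans (eraseIdx_sublist_translocate hi), by omega⟩

/-- The Ulam distance of two rearrangements of a repetition-free sequence is at most `t` iff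
they have a common subsequence missing at most `t` symbols. -/
theorem ulamDist_le_iff {x y : List α} (hy : y.Nodup) (hp : x.Perm y) {t : ℕ} :
    ulamDist x y ≤ t ↔ ∃ z : List α, z.Sublist x ∧ z.Sublist y ∧ x.length ≤ z.length + t := by
  constructor
  · intro h
    obtain ⟨m₀, -, hm₀⟩ := exists_translocationPath_le hy y.length hp
      (List.nil_sublist x) (List.nil_sublist y) (by simp)
    have hmem : TranslocationPath x y (ulamDist x y) :=
      Nat.sInf_mem (s := {m | TranslocationPath x y m}) ⟨m₀, hm₀⟩
    obtain ⟨z, hx, hzy, hlen⟩ := hmem.exists_sublist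
    exact ⟨z, hx, hzy, by omega⟩
  · rintro ⟨z, hx, hzy, hlen⟩
    obtain ⟨m, hm, hpath⟩ :=
      exists_translocationPath_le hy t hp hx hzy (hp.length_eq ▸ hlen)
    exact (Nat.sInf_le (s := {m | TranslocationPath x y m}) hpath).trans hm

end

theorem length_seqOf {n : ℕ} (π : Equiv.Perm (Fin n)) : (seqOf π).length = n := by
  simp [seqOf]

theorem nodup_seqOf {n : ℕ} (π : Equiv.Perm (Fin n)) : (seqOf π).Nodup :=
  List.nodup_ofFn.2 fun i j h => π.injective (Fin.ext (by simpa using h))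

theorem mem_seqOf {n : ℕ} (π : Equiv.Perm (Fin n)) (a : ℕ) :
    a ∈ seqOf π ↔ ∃ i : Fin n, (i : ℕ) + 1 = a := by
  simp only [seqOf, List.mem_ofFn]
  exact π.exists_congr_left.trans (by simp)

theorem seqOf_perm {n : ℕ} (π σ : Equiv.Perm (Fin n)) : (seqOf π).Perm (seqOf σ) :=
  (List.perm_ext_iff_of_nodup (nodup_seqOf π) (nodup_seqOf σ)).2 fun a => by
    rw [mem_seqOf, mem_seqOf]

theorem Dball_inter_nonempty_iff {n t : ℕ} (π σ : Equiv.Perm (Fin n)) :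
    (Dball t π ∩ Dball t σ).Nonempty ↔ dU π σ ≤ t := by
  rw [dU, ulamDist_le_iff (nodup_seqOf σ) (seqOf_perm π σ), length_seqOf]
  constructor
  · rintro ⟨z, ⟨h₁, hlen⟩, h₂, -⟩
    exact ⟨z, h₁, h₂, by omega⟩
  · rintro ⟨z, h₁, h₂, hlen⟩
    have hs : (z.take (n - t)).Sublist z := List.take_sublist _ _
    have hl : (z.take (n - t)).length = n - t := by
      rw [List.length_take]; omega
    exact ⟨z.take (n - t), ⟨hs.trans h₁, hl⟩, hs.trans h₂, hl⟩

/-- a permutation code `C ⊆ S_n` corrects `t` deletions (its deletion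
balls are pairwise disjoint) iff `d_U(π,σ) > t` for all distinct `π, σ ∈ C`. -/
theorem stmt11 (n t : ℕ) (C : Set (Equiv.Perm (Fin n))) :
    (∀ π ∈ C, ∀ σ ∈ C, π ≠ σ → Dball t π ∩ Dball t σ = ∅) ↔
    (∀ π ∈ C, ∀ σ ∈ C, π ≠ σ → t < dU π σ) := by
  simp only [← Set.not_nonempty_iff_eq_empty, Dball_inter_nonempty_iff, not_le]
end

section
/- Let C ⊆ S_n be a permutation code such that d_H(f(π̄), f(σ̄)) ≥ 3t + 1 for all distinct π, σ ∈ C. Then C is capable of correcting t deletions, i.e., D_t(π) ∩ D_t(σ) = ∅ for all distinct π, σ ∈ C. -/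
open scoped Classical

open Finset in
/-- If a set `A` of symbols is listed in the same order by `p` and `q`,
and both fix the last symbol, then the cyclic successor maps of `p` and `q` differ in at most
`3 * #Aᶜ` positions. -/
theorem dH_conj_finRotate_le {n : ℕ} (p q : Equiv.Perm (Fin (n + 1)))
    (hp : p (Fin.last n) = Fin.last n) (hq : q (Fin.last n) = Fin.last n)
    (A : Finset (Fin (n + 1)))
    (h : ∀ a ∈ A, ∀ b ∈ A, p⁻¹ a < p⁻¹ b ↔ q⁻¹ a < q⁻¹ b) :
    dH (p * finRotate (n + 1) * p⁻¹) (q * finRotate (n + 1) * q⁻¹) ≤ 3 * #Aᶜ := by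
  set F := p * finRotate (n + 1) * p⁻¹ with hF
  set G := q * finRotate (n + 1) * q⁻¹ with hG
  have agree : ∀ x ∈ A, F x ∈ A → G x ∈ A → F x = G x := by
    intro x hx hFx hGx
    have pF : p⁻¹ (F x) = finRotate (n + 1) (p⁻¹ x) := by simp [hF]
    have qG : q⁻¹ (G x) = finRotate (n + 1) (q⁻¹ x) := by simp [hG]
    have key : p⁻¹ (F x) ≤ p⁻¹ (G x) ∧ q⁻¹ (G x) ≤ q⁻¹ (F x) := by
      by_cases hl : x = Fin.last n
      · have hp' : p⁻¹ x = Fin.last n := by rw [hl, Equiv.Perm.inv_eq_iff_eq, hp]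
        have hq' : q⁻¹ x = Fin.last n := by rw [hl, Equiv.Perm.inv_eq_iff_eq, hq]
        rw [pF, qG, hp', hq', finRotate_last]
        exact ⟨Fin.zero_le _, Fin.zero_le _⟩
      · have hp' : p⁻¹ x ≠ Fin.last n := by rwa [Ne, Equiv.Perm.inv_eq_iff_eq, hp]
        have hq' : q⁻¹ x ≠ Fin.last n := by rwa [Ne, Equiv.Perm.inv_eq_iff_eq, hq]
        have cp := coe_finRotate_of_ne_last hp'
        have cq := coe_finRotate_of_ne_last hq'
        rw [← pF] at cp
        rw [← qG] at cq
        have h1 := (h x hx _ hFx).1 (by rw [Fin.lt_def]; omega)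
        have h2 := (h x hx _ hGx).2 (by rw [Fin.lt_def]; omega)
        simp only [Fin.le_def, Fin.lt_def] at *
        omega
    have h1 : ¬ p⁻¹ (F x) < p⁻¹ (G x) := by
      rw [h _ hFx _ hGx]
      exact not_lt.2 key.2
    exact p⁻¹.injective (le_antisymm key.1 (not_lt.1 h1))
  have hsub : univ.filter (fun i => F i ≠ G i) ⊆
      Aᶜ ∪ Aᶜ.image F.symm ∪ Aᶜ.image G.symm := by
    intro x hx
    have hne := (mem_filter.1 hx).2
    by_contra hcon
    simp only [mem_union, mem_image, mem_compl, not_or, not_not, not_exists, not_and] at hcon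
    obtain ⟨⟨h1, h2⟩, h3⟩ := hcon
    refine hne (agree x h1 ?_ ?_)
    · by_contra h'
      exact h2 _ h' (F.symm_apply_apply x)
    · by_contra h'
      exact h3 _ h' (G.symm_apply_apply x)
  have hcard : dH F G ≤ #(Aᶜ ∪ Aᶜ.image F.symm ∪ Aᶜ.image G.symm) := by
    unfold dH
    convert card_le_card hsub
  have c1 := card_union_le (Aᶜ ∪ Aᶜ.image F.symm) (Aᶜ.image G.symm)
  have c2 := card_union_le Aᶜ (Aᶜ.image F.symm)
  have c3 : #(Aᶜ.image F.symm) ≤ #Aᶜ := card_image_le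
  have c4 : #(Aᶜ.image G.symm) ≤ #Aᶜ := card_image_le
  omega

theorem bar_last {n : ℕ} (π : Equiv.Perm (Fin n)) : bar π (Fin.last n) = Fin.last n := by
  simp [bar, Equiv.permCongr]

theorem bar_castSucc {n : ℕ} (π : Equiv.Perm (Fin n)) (i : Fin n) :
    bar π i.castSucc = (π i).castSucc := by
  simp [bar, Equiv.permCongr]

/-- A subsequence of `π` is listed by a strictly increasing sequence of positions. -/
theorem exists_strictMono_of_sublist_seqOf {n : ℕ} {π : Equiv.Perm (Fin n)} {s : List ℕ}
    (hs : s.Sublist (seqOf π)) :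
    ∃ f : Fin s.length → Fin n, StrictMono f ∧ ∀ i, s.get i = (π (f i) : ℕ) + 1 := by
  obtain ⟨f, hf⟩ := List.sublist_iff_exists_fin_orderEmbedding_get_eq.1 hs
  have hlen : (seqOf π).length = n := by simp [seqOf]
  refine ⟨fun i => (f i).cast hlen, fun i j hij => ?_, fun i => ?_⟩
  · exact f.strictMono hij
  · rw [hf i]
    simp [seqOf]
    rfl

open Finset in
theorem dH_fmap_le_of_common_subsequence {n t : ℕ} {π σ : Equiv.Perm (Fin n)} {s : List ℕ}
    (hπ : s ∈ Dball t π) (hσ : s ∈ Dball t σ) : dH (fmap π) (fmap σ) ≤ 3 * t := by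
  obtain ⟨f, hf, hf'⟩ := exists_strictMono_of_sublist_seqOf hπ.1
  obtain ⟨g, hg, hg'⟩ := exists_strictMono_of_sublist_seqOf hσ.1
  have hfg : ∀ i, π (f i) = σ (g i) := fun i => Fin.ext (by have := hf' i; have := hg' i; omega)
  have hinj : Function.Injective fun i => (π (f i)).castSucc :=
    (Fin.castSucc_injective n).comp (π.injective.comp hf.injective)
  set B : Finset (Fin (n + 1)) := univ.image fun i => (π (f i)).castSucc with hB
  have hlB : Fin.last n ∉ B := by
    simp [hB, Fin.castSucc_ne_last]
  have hcard : #(insert (Fin.last n) B)ᶜ ≤ t := by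
    rw [card_compl, card_insert_of_notMem hlB, hB, card_image_of_injective _ hinj]
    have := hπ.2
    simp only [card_univ, Fintype.card_fin]
    omega
  have pl : (bar π)⁻¹ (Fin.last n) = Fin.last n := by
    rw [Equiv.Perm.inv_eq_iff_eq, bar_last]
  have ql : (bar σ)⁻¹ (Fin.last n) = Fin.last n := by
    rw [Equiv.Perm.inv_eq_iff_eq, bar_last]
  have pc : ∀ i, (bar π)⁻¹ (π (f i)).castSucc = (f i).castSucc := fun i => by
    rw [Equiv.Perm.inv_eq_iff_eq, bar_castSucc]
  have qc : ∀ i, (bar σ)⁻¹ (π (f i)).castSucc = (g i).castSucc := fun i => by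
    rw [Equiv.Perm.inv_eq_iff_eq, bar_castSucc, hfg]
  refine (dH_conj_finRotate_le (bar π) (bar σ) (bar_last π) (bar_last σ)
    (insert (Fin.last n) B) fun a ha b hb => ?_).trans
    (Nat.mul_le_mul_left 3 hcard)
  simp only [hB, mem_insert, mem_image, mem_univ, true_and] at ha hb
  rcases ha with rfl | ⟨i, rfl⟩ <;> rcases hb with rfl | ⟨j, rfl⟩
  · simp only [pl, ql]
  · simp only [pl, ql, pc, qc, (Fin.castSucc_lt_last _).not_gt]
  · simp only [pl, ql, pc, qc, Fin.castSucc_lt_last]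
  · simp only [pc, qc, Fin.castSucc_lt_castSucc_iff, hf.lt_iff_lt, hg.lt_iff_lt]

/-- if `d_H(f(π̄), f(σ̄)) ≥ 3t+1` for all distinct `π, σ ∈ C`, then
`C` corrects `t` deletions. -/
theorem stmt12 (n t : ℕ) (C : Set (Equiv.Perm (Fin n)))
    (hC : ∀ π ∈ C, ∀ σ ∈ C, π ≠ σ → 3 * t + 1 ≤ dH (fmap π) (fmap σ)) :
    ∀ π ∈ C, ∀ σ ∈ C, π ≠ σ → Dball t π ∩ Dball t σ = ∅ := by
  intro π hπ σ hσ hne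
  refine Set.eq_empty_iff_forall_notMem.2 fun s hs => ?_
  have h1 := hC π hπ σ hσ hne
  have h2 := dH_fmap_le_of_common_subsequence hs.1 hs.2
  omega
end

section
/- For integers t ≥ 1 and n with n + 1 ≥ 3t + 1 ≥ 4, there exists a permutation code C ⊆ S_n capable of correcting t deletions whose size satisfies |C| ≥ n! / p^{3t−1}, where p is the smallest prime greater than or equal to n + 1. -/
open scoped Classical

theorem fmap_bar {n : ℕ} (π : Equiv.Perm (Fin n)) (k : Fin (n + 1)) :
    fmap π (bar π k) = bar π (k + 1) := by
  simp [fmap]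

theorem fmap_injective (n : ℕ) : Function.Injective (fmap (n := n)) := by
  intro π σ h
  have key : ∀ k : Fin (n + 1), bar π k = bar σ k := by
    intro k
    induction k using Fin.induction with
    | zero =>
      have h1 := fmap_bar π (Fin.last n)
      have h2 := fmap_bar σ (Fin.last n)
      rw [Fin.last_add_one, bar_last] at h1 h2
      rw [← h1, ← h2, h]
    | succ k ih =>
      have h1 := fmap_bar π k.castSucc
      have h2 := fmap_bar σ k.castSucc
      rw [Fin.coeSucc_eq_succ] at h1 h2
      rw [← h1, ← h2, h, ih]
  ext i
  simpa [bar_castSucc] using congrArg Fin.val (key i.castSucc)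

/-- If two permutations list the symbols of `S` in the same relative order, then cyclic successors
lying in `S` of a symbol of `S` agree. -/
theorem fmap_eq_of_mem {n : ℕ} {π σ : Equiv.Perm (Fin n)} {S : Finset (Fin (n + 1))}
    (hS : ∀ k l k' l', bar π k = bar σ k' → bar π l = bar σ l' → bar π k ∈ S → bar π l ∈ S →
      (k ≤ l ↔ k' ≤ l'))
    {i : Fin (n + 1)} (hi : i ∈ S) (hπ : fmap π i ∈ S) (hσ : fmap σ i ∈ S) :
    fmap π i = fmap σ i := by
  obtain ⟨k, rfl⟩ := (bar π).surjective i
  obtain ⟨k', hk⟩ := (bar σ).surjective (bar π k)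
  rw [fmap_bar] at hπ ⊢
  rw [← hk, fmap_bar] at hσ ⊢
  obtain ⟨b, hb⟩ := (bar σ).surjective (bar π (k + 1))
  obtain ⟨c, hc⟩ := (bar π).surjective (bar σ (k' + 1))
  have h1 := hS (k + 1) c b (k' + 1) hb.symm hc hπ (hc ▸ hσ)
  have h2 := hS (k + 1) k b k' hb.symm hk.symm hπ hi
  have h3 := hS c k (k' + 1) k' hc hk.symm (hc ▸ hσ) hi
  have hle : k + 1 ≤ c ∧ k' + 1 ≤ b := by
    rcases Fin.eq_castSucc_or_eq_last k with ⟨j, rfl⟩ | rfl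
    · rcases Fin.eq_castSucc_or_eq_last k' with ⟨j', rfl⟩ | rfl
      · simp only [Fin.coeSucc_eq_succ, Fin.le_def, Fin.val_succ, Fin.val_castSucc] at *
        omega
      · rw [bar_last, ← bar_last π] at hk
        exact absurd ((bar π).injective hk).symm (Fin.castSucc_lt_last j).ne
    · rw [bar_last, ← bar_last σ] at hk
      obtain rfl := (bar σ).injective hk
      simp
  have hb' : b ≤ k' + 1 := h1.1 hle.1
  rw [← hb, le_antisymm hb' hle.2]

theorem exists_common_symbols {n t : ℕ} (htn : t ≤ n) {π σ : Equiv.Perm (Fin n)} {s : List ℕ}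
    (hπ : s ∈ Dball t π) (hσ : s ∈ Dball t σ) :
    ∃ S : Finset (Fin (n + 1)), Sᶜ.card = t ∧
      ∀ k l k' l', bar π k = bar σ k' → bar π l = bar σ l' → bar π k ∈ S → bar π l ∈ S →
        (k ≤ l ↔ k' ≤ l') := by
  obtain ⟨g, hg⟩ := List.sublist_iff_exists_fin_orderEmbedding_get_eq.1 hπ.1
  obtain ⟨h, hh⟩ := List.sublist_iff_exists_fin_orderEmbedding_get_eq.1 hσ.1
  have hlen : s.length = n - t := hπ.2
  have lenπ : (seqOf π).length = n := by simp [seqOf]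
  have lenσ : (seqOf σ).length = n := by simp [seqOf]
  let g' : Fin s.length ↪o Fin n := g.trans (Fin.castOrderIso lenπ).toOrderEmbedding
  let h' : Fin s.length ↪o Fin n := h.trans (Fin.castOrderIso lenσ).toOrderEmbedding
  have hgh : ∀ x, π (g' x) = σ (h' x) := by
    intro x
    have := (hg x).symm.trans (hh x)
    simp only [seqOf, List.get_eq_getElem, List.getElem_ofFn, Nat.add_right_cancel_iff] at this
    exact Fin.ext this
  have hinj : Function.Injective fun x => (π (g' x)).castSucc :=
    (Fin.castSucc_injective n).comp (π.injective.comp g'.injective)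
  let S : Finset (Fin (n + 1)) :=
    insert (Fin.last n) (Finset.univ.image fun x => (π (g' x)).castSucc)
  have hcard : S.card = n - t + 1 := by
    rw [Finset.card_insert_of_notMem, Finset.card_image_of_injective _ hinj]
    · simp [hlen]
    · simp [Fin.castSucc_ne_last]
  have hmem : ∀ k k', bar π k = bar σ k' → bar π k ∈ S →
      (k = Fin.last n ∧ k' = Fin.last n) ∨
        ∃ x, k = (g' x).castSucc ∧ k' = (h' x).castSucc := by
    intro k k' hk hkS
    rcases Finset.mem_insert.1 hkS with hl | hx
    · left
      exact ⟨(bar π).injective (hl.trans (bar_last π).symm),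
        (bar σ).injective ((hk.symm.trans hl).trans (bar_last σ).symm)⟩
    · right
      obtain ⟨x, -, hx⟩ := Finset.mem_image.1 hx
      refine ⟨x, (bar π).injective ?_, (bar σ).injective ?_⟩
      · rw [bar_castSucc, ← hx]
      · rw [bar_castSucc, ← hgh, ← hk, ← hx]
  refine ⟨S, ?_, ?_⟩
  · rw [Finset.card_compl, hcard, Fintype.card_fin]
    omega
  · intro k l k' l' hk hl hkS hlS
    rcases hmem k k' hk hkS with ⟨rfl, rfl⟩ | ⟨x, rfl, rfl⟩ <;>
      rcases hmem l l' hl hlS with ⟨rfl, rfl⟩ | ⟨y, rfl, rfl⟩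
    · simp
    · simp [Fin.last_le_iff, Fin.castSucc_ne_last]
    · simp [Fin.le_last]
    · simp

/-- Permutations sharing a subsequence of length `n - t` have images under `fmap` at Hamming
distance at most `3 * t`. -/
theorem dH_fmap_le {n t : ℕ} (htn : t ≤ n) {π σ : Equiv.Perm (Fin n)} {s : List ℕ}
    (hπ : s ∈ Dball t π) (hσ : s ∈ Dball t σ) : dH (fmap π) (fmap σ) ≤ 3 * t := by
  obtain ⟨S, hcard, hS⟩ := exists_common_symbols htn hπ hσ
  have hsub : (Finset.univ.filter fun i => fmap π i ≠ fmap σ i) ⊆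
      Sᶜ ∪ Sᶜ.image (fmap π).symm ∪ Sᶜ.image (fmap σ).symm := by
    intro i hi
    by_contra hcon
    simp only [Finset.mem_union, Finset.mem_compl, Finset.mem_image, not_or, not_not,
      not_exists, not_and] at hcon
    obtain ⟨⟨h1, h2⟩, h3⟩ := hcon
    refine (Finset.mem_filter.1 hi).2 (fmap_eq_of_mem hS h1 ?_ ?_)
    · by_contra h
      exact h2 _ h (Equiv.symm_apply_apply _ _)
    · by_contra h
      exact h3 _ h (Equiv.symm_apply_apply _ _)
  calc dH (fmap π) (fmap σ)
      ≤ (Sᶜ ∪ Sᶜ.image (fmap π).symm ∪ Sᶜ.image (fmap σ).symm).card := by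
        unfold dH
        convert Finset.card_le_card hsub
    _ ≤ Sᶜ.card + Sᶜ.card + Sᶜ.card :=
        (Finset.card_union_le _ _).trans (add_le_add ((Finset.card_union_le _ _).trans
          (add_le_add le_rfl Finset.card_image_le)) Finset.card_image_le)
    _ = 3 * t := by omega

/-- A vector with at most `d` nonzero entries whose first `d` moments at distinct nodes vanish
is zero (minimum distance of a Reed-Solomon code). -/
theorem eq_zero_of_moments_eq_zero {ι K : Type*} [Fintype ι] [Field K] {x : ι → K}
    (hx : Function.Injective x) {e : ι → K} {d : ℕ}
    (hd : (Finset.univ.filter fun i => e i ≠ 0).card ≤ d)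
    (hm : ∀ j < d, ∑ i, e i * x i ^ j = 0) : e = 0 := by
  funext i
  by_contra hi
  replace hi : e i ≠ 0 := hi
  set D := Finset.univ.filter fun i => e i ≠ 0 with hD
  have hiD : i ∈ D := by simpa [hD] using hi
  let Q : Polynomial K := ∏ k ∈ D.erase i, (Polynomial.X - Polynomial.C (x k))
  have hdeg : Q.natDegree < d := by
    rw [Polynomial.natDegree_finsetProd_X_sub_C_eq_card]
    exact (Finset.card_erase_lt_of_mem hiD).trans_le hd
  have hsum : ∑ k, e k * Q.eval (x k) = 0 := by
    simp_rw [Polynomial.eval_eq_sum_range' hdeg, Finset.mul_sum]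
    rw [Finset.sum_comm]
    refine Finset.sum_eq_zero fun j hj => ?_
    rw [← mul_zero (Q.coeff j), ← hm j (Finset.mem_range.1 hj), Finset.mul_sum]
    exact Finset.sum_congr rfl fun k _ => by ring
  rw [Finset.sum_eq_single i] at hsum
  · rcases mul_eq_zero.1 hsum with h | h
    · exact hi h
    · rw [Polynomial.eval_prod, Finset.prod_eq_zero_iff] at h
      obtain ⟨k, hk, hk0⟩ := h
      rw [Polynomial.eval_sub, Polynomial.eval_X, Polynomial.eval_C, sub_eq_zero] at hk0
      exact (Finset.mem_erase.1 hk).1 (hx hk0).symm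
  · intro k _ hki
    by_cases hk : e k = 0
    · rw [hk, zero_mul]
    · have hkD : k ∈ D.erase i := Finset.mem_erase.2 ⟨hki, by simpa [hD] using hk⟩
      rw [Polynomial.eval_prod, Finset.prod_eq_zero hkD (by simp), mul_zero]
  · exact fun h => absurd (Finset.mem_univ i) h

theorem Fin.natCast_zmod_injective {m p : ℕ} (h : m ≤ p) :
    Function.Injective fun i : Fin m => ((i : ℕ) : ZMod p) := by
  intro i j hij
  exact Fin.ext (Nat.ModEq.eq_of_lt_of_lt ((ZMod.natCast_eq_natCast_iff _ _ _).1 hij)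
    (i.2.trans_le h) (j.2.trans_le h))

/-- The moments of order `1, …, r` of a permutation, as elements of `ZMod p`. -/
def moments {m : ℕ} (p r : ℕ) (a : Equiv.Perm (Fin m)) : Fin r → ZMod p :=
  fun j => ∑ i, ((a i : ℕ) : ZMod p) * ((i : ℕ) : ZMod p) ^ ((j : ℕ) + 1)

/-- Permutations with the same first `r` moments and Hamming distance at most `r + 1` coincide;
the moment of order `0` is the same for all permutations. -/
theorem eq_of_moments_eq {m p r : ℕ} [Fact p.Prime] (hmp : m ≤ p) {a b : Equiv.Perm (Fin m)}
    (hab : moments p r a = moments p r b) (hd : dH a b ≤ r + 1) : a = b := by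
  have hinj := Fin.natCast_zmod_injective hmp
  have h0 : (fun i => ((a i : ℕ) : ZMod p) - ((b i : ℕ) : ZMod p)) = 0 := by
    refine eq_zero_of_moments_eq_zero hinj (d := r + 1) ?_ ?_
    · refine le_trans (Finset.card_le_card ?_) hd
      intro i hi
      simp only [Finset.mem_filter, Finset.mem_univ, true_and] at hi ⊢
      exact fun h => hi (by rw [h, sub_self])
    · intro j hj
      simp_rw [sub_mul, Finset.sum_sub_distrib]
      rw [sub_eq_zero]
      cases j with
      | zero =>
        simp only [pow_zero, mul_one]
        rw [Equiv.sum_comp a fun i => ((i : ℕ) : ZMod p),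
          Equiv.sum_comp b fun i => ((i : ℕ) : ZMod p)]
      | succ j => exact congrFun hab ⟨j, by omega⟩
  ext i
  exact congrArg Fin.val (hinj (sub_eq_zero.1 (congrFun h0 i)))

theorem exists_card_le_card_fiber_mul {α β : Type*} [Fintype α] [Fintype β] [Nonempty β]
    (f : α → β) :
    ∃ y, Fintype.card α ≤ (Finset.univ.filter fun a => f a = y).card * Fintype.card β := by
  obtain ⟨y, -, hy⟩ := Finset.exists_max_image Finset.univ
    (fun y => (Finset.univ.filter fun a => f a = y).card) Finset.univ_nonempty
  refine ⟨y, ?_⟩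
  exact Finset.card_le_mul_card_image_of_maps_to (fun a _ => Finset.mem_univ (f a)) _ hy

/-- for `t ≥ 1` and `n + 1 ≥ 3t + 1`, there is a permutation code
`C ⊆ S_n` correcting `t` deletions with `|C| ≥ n! / p^{3t−1}`, where `p` is the smallest
prime `≥ n + 1`. -/
theorem stmt13 (t n : ℕ) (ht : 1 ≤ t) (hn : 3 * t + 1 ≤ n + 1)
    (p : ℕ) (hp : p.Prime) (hpn : n + 1 ≤ p)
    (hmin : ∀ q : ℕ, q.Prime → n + 1 ≤ q → p ≤ q) :
    ∃ C : Finset (Equiv.Perm (Fin n)),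
      (∀ π ∈ C, ∀ σ ∈ C, π ≠ σ → Dball t π ∩ Dball t σ = ∅) ∧
      n.factorial ≤ C.card * p ^ (3 * t - 1) := by
  have : Fact p.Prime := ⟨hp⟩
  obtain ⟨y, hy⟩ := exists_card_le_card_fiber_mul
    fun π : Equiv.Perm (Fin n) => moments p (3 * t - 1) (fmap π)
  refine ⟨Finset.univ.filter fun π => moments p (3 * t - 1) (fmap π) = y, ?_, ?_⟩
  · intro π hπ σ hσ hne
    rw [Set.eq_empty_iff_forall_notMem]
    rintro s ⟨hsπ, hsσ⟩
    refine hne (fmap_injective n (eq_of_moments_eq hpn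
      ((Finset.mem_filter.1 hπ).2.trans (Finset.mem_filter.1 hσ).2.symm) ?_))
    have := dH_fmap_le (by omega) hsπ hsσ
    omega
  · rw [Fintype.card_perm, Fintype.card_fin, Fintype.card_fun, ZMod.card, Fintype.card_fin] at hy
    convert hy
end

section
/- For any two permutations π, σ ∈ S_n, d_H(f(π̄), f(σ̄)) ≤ 3·d_K̄(π,σ), where d_K̄ is the generalized Kendall-τ distance. -/
open scoped Classical

/-- Swap the two adjacent blocks of positions `[i,j)` and `[j,k)` of a sequence. -/
def swapAdjBlocks {α : Type*} (l : List α) (i j k : ℕ) : List α :=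
  l.take i ++ ((l.drop j).take (k - j)) ++ ((l.drop i).take (j - i)) ++ l.drop k

/-- Kendall-τ distance: minimum number of adjacent transpositions (swaps of symbols in
consecutive positions) needed to transform `x` into `y`. -/
noncomputable def kendallDist {α : Type*} (x y : List α) : ℕ :=
  sInf {m | ∃ g : ℕ → List α, g 0 = x ∧ g m = y ∧
    ∀ l < m, ∃ i, i + 2 ≤ (g l).length ∧ g (l+1) = swapAdjBlocks (g l) i (i+1) (i+2)}

/-- Generalized Kendall-τ distance: minimum number of generalized adjacent
transpositions (swaps of two nonempty adjacent blocks) needed to transform `x` into `y`. -/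
noncomputable def genKendallDist {α : Type*} (x y : List α) : ℕ :=
  sInf {m | ∃ g : ℕ → List α, g 0 = x ∧ g m = y ∧
    ∀ l < m, ∃ i j k, i < j ∧ j < k ∧ k ≤ (g l).length ∧
      g (l+1) = swapAdjBlocks (g l) i j k}

/-- The set of pairs of consecutive entries of a list. -/
def consecPairs {α : Type*} [DecidableEq α] (l : List α) : Finset (α × α) :=
  (l.zip l.tail).toFinset

theorem consecPairs_cons_cons {α : Type*} [DecidableEq α] (a b : α) (l : List α) :
    consecPairs (a :: b :: l) = insert (a, b) (consecPairs (b :: l)) := by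
  ext; simp [consecPairs]

theorem consecPairs_append {α : Type*} [DecidableEq α] (X Y : List α) (hX : X ≠ []) (hY : Y ≠ []) :
    consecPairs (X ++ Y) =
      insert (X.getLast hX, Y.head hY) (consecPairs X ∪ consecPairs Y) := by
  induction X with
  | nil => exact absurd rfl hX
  | cons a X ih =>
    cases X with
    | nil =>
      obtain ⟨b, Y, rfl⟩ := List.exists_cons_of_ne_nil hY
      have : consecPairs [a] = ∅ := by simp [consecPairs]
      simp [consecPairs_cons_cons, this]
    | cons b X =>
      have := ih (List.cons_ne_nil _ _)
      simp only [List.cons_append] at this ⊢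
      rw [consecPairs_cons_cons, this, consecPairs_cons_cons, List.getLast_cons (List.cons_ne_nil b X)]
      ext p
      simp only [Finset.mem_insert, Finset.mem_union]
      tauto

theorem card_consecPairs_sdiff_swap_le {α : Type*} [DecidableEq α] (A B C D : List α)
    (hA : A ≠ []) (hB : B ≠ []) (hC : C ≠ []) (hD : D ≠ []) :
    (consecPairs (A ++ (B ++ (C ++ D))) \ consecPairs (A ++ (C ++ (B ++ D)))).card ≤ 3 := by
  have hCD : C ++ D ≠ [] := by simp [hC]
  have hBD : B ++ D ≠ [] := by simp [hB]
  have hBCD : B ++ (C ++ D) ≠ [] := by simp [hB]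
  have hCBD : C ++ (B ++ D) ≠ [] := by simp [hC]
  refine (Finset.card_le_card (t := {(A.getLast hA, (B ++ (C ++ D)).head hBCD),
    (B.getLast hB, (C ++ D).head hCD), (C.getLast hC, D.head hD)}) ?_).trans
    Finset.card_le_three
  rw [consecPairs_append A _ hA hBCD, consecPairs_append B _ hB hCD,
    consecPairs_append C _ hC hD, consecPairs_append A _ hA hCBD,
    consecPairs_append C _ hC hBD, consecPairs_append B _ hB hD]
  intro p
  simp only [Finset.mem_sdiff, Finset.mem_insert, Finset.mem_union, Finset.mem_singleton]
  tauto

/-- The relation of being one generalized adjacent transposition apart. -/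
def BlockSwap {α : Type*} (l l' : List α) : Prop :=
  ∃ i j k, i < j ∧ j < k ∧ k ≤ l.length ∧ l' = swapAdjBlocks l i j k

theorem BlockSwap.exists_blocks {α : Type*} {l l' : List α} (h : BlockSwap l l') :
    ∃ A B C D : List α, B ≠ [] ∧ C ≠ [] ∧
      l = A ++ (B ++ (C ++ D)) ∧ l' = A ++ (C ++ (B ++ D)) := by
  obtain ⟨i, j, k, hij, hjk, hk, rfl⟩ := h
  refine ⟨l.take i, (l.drop i).take (j - i), (l.drop j).take (k - j), l.drop k, ?_, ?_, ?_, ?_⟩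
  · rw [← List.length_pos_iff]
    simp
    omega
  · rw [← List.length_pos_iff]
    simp
    omega
  · have h₁ : (l.drop j).take (k - j) ++ l.drop k = l.drop j := by
      conv_rhs => rw [← List.take_append_drop (k - j) (l.drop j), List.drop_drop,
        Nat.add_sub_cancel' hjk.le]
    have h₂ : (l.drop i).take (j - i) ++ l.drop j = l.drop i := by
      conv_rhs => rw [← List.take_append_drop (j - i) (l.drop i), List.drop_drop,
        Nat.add_sub_cancel' hij.le]
    rw [h₁, h₂, List.take_append_drop]
  · simp [swapAdjBlocks]

theorem BlockSwap.cons {α : Type*} (a : α) {l l' : List α} (h : BlockSwap l l') :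
    BlockSwap (a :: l) (a :: l') := by
  obtain ⟨i, j, k, hij, hjk, hk, rfl⟩ := h
  exact ⟨i + 1, j + 1, k + 1, by omega, by omega, by simpa using hk, by simp [swapAdjBlocks]⟩

theorem List.Perm.reflTransGen_blockSwap {α : Type*} {x y : List α} (h : x.Perm y) :
    Relation.ReflTransGen BlockSwap x y := by
  induction h with
  | nil => exact .refl
  | cons a _ ih => exact ih.lift (a :: ·) fun _ _ => BlockSwap.cons a
  | swap a b l => exact .single ⟨0, 1, 2, by omega, by omega, by simp, by simp [swapAdjBlocks]⟩
  | trans _ _ ih₁ ih₂ => exact ih₁.trans ih₂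

theorem exists_seq_of_reflTransGen {α : Type*} {r : α → α → Prop} {x y : α}
    (h : Relation.ReflTransGen r x y) :
    ∃ (m : ℕ) (g : ℕ → α), g 0 = x ∧ g m = y ∧ ∀ k < m, r (g k) (g (k + 1)) := by
  induction h using Relation.ReflTransGen.head_induction_on with
  | refl => exact ⟨0, fun _ => y, rfl, rfl, by simp⟩
  | @head a b hab _ ih =>
    obtain ⟨m, g, h0, hm, hg⟩ := ih
    refine ⟨m + 1, fun k => Nat.casesOn k a g, rfl, hm, fun k hk => ?_⟩
    cases k with
    | zero => simpa [h0] using hab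
    | succ k => exact hg k (by omega)

/-- A minimal sequence of block swaps between two rearrangements of the same list. -/
theorem exists_seq_genKendallDist {α : Type*} {x y : List α} (h : x.Perm y) :
    ∃ g : ℕ → List α, g 0 = x ∧ g (genKendallDist x y) = y ∧
      ∀ k < genKendallDist x y, BlockSwap (g k) (g (k + 1)) :=
  Nat.sInf_mem (s := {m | ∃ g : ℕ → List α, g 0 = x ∧ g m = y ∧
    ∀ l < m, BlockSwap (g l) (g (l + 1))}) (exists_seq_of_reflTransGen h.reflTransGen_blockSwap)

theorem card_sdiff_le_of_seq {α : Type*} [DecidableEq α] (P : ℕ → Finset α) (c m : ℕ)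
    (h : ∀ k < m, (P k \ P (k + 1)).card ≤ c) : (P 0 \ P m).card ≤ c * m := by
  induction m with
  | zero => simp
  | succ m ih =>
    calc (P 0 \ P (m + 1)).card ≤ ((P 0 \ P m) ∪ (P m \ P (m + 1))).card :=
          Finset.card_le_card fun p => by
            simp only [Finset.mem_sdiff, Finset.mem_union]
            tauto
      _ ≤ (P 0 \ P m).card + (P m \ P (m + 1)).card := Finset.card_union_le _ _
      _ ≤ c * m + c := Nat.add_le_add (ih fun k hk => h k (by omega)) (h m (by omega))
      _ = c * (m + 1) := by ring

theorem BlockSwap.card_consecPairs_sdiff_le {α : Type*} [DecidableEq α] (a : α) {l l' : List α}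
    (h : BlockSwap l l') :
    (consecPairs (a :: (l ++ [a])) \ consecPairs (a :: (l' ++ [a]))).card ≤ 3 := by
  obtain ⟨A, B, C, D, hB, hC, rfl, rfl⟩ := h.exists_blocks
  simpa using card_consecPairs_sdiff_swap_le (a :: A) B C (D ++ [a]) (by simp) hB hC (by simp)

theorem finRotate_symm_zero (n : ℕ) : (finRotate (n + 1)).symm 0 = Fin.last n := by
  rw [Equiv.symm_apply_eq, finRotate_last]

theorem finRotate_symm_succ {n : ℕ} (i : Fin n) :
    (finRotate (n + 1)).symm i.succ = i.castSucc := by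
  rw [Equiv.symm_apply_eq]
  simp

theorem seqOf_append_last {n : ℕ} (π : Equiv.Perm (Fin n)) :
    seqOf π ++ [n + 1] = List.ofFn fun k : Fin (n + 1) => (bar π k : ℕ) + 1 := by
  rw [List.ofFn_succ_last]
  simp [seqOf, bar_last, bar_castSucc]

theorem last_cons_seqOf {n : ℕ} (π : Equiv.Perm (Fin n)) :
    (n + 1) :: seqOf π =
      List.ofFn fun k : Fin (n + 1) => (bar π ((finRotate (n + 1)).symm k) : ℕ) + 1 := by
  rw [List.ofFn_succ]
  simp only [finRotate_symm_zero, finRotate_symm_succ, bar_last, bar_castSucc]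
  simp [seqOf]

theorem mem_consecPairs_seqOf {n : ℕ} (π : Equiv.Perm (Fin n)) (p : ℕ × ℕ) :
    p ∈ consecPairs ((n + 1) :: (seqOf π ++ [n + 1])) ↔
      ∃ i : Fin (n + 1), p = ((i : ℕ) + 1, (fmap π i : ℕ) + 1) := by
  have hzip : ((n + 1) :: (seqOf π ++ [n + 1])).zip (seqOf π ++ [n + 1]) =
      List.ofFn fun k : Fin (n + 1) =>
        ((bar π ((finRotate (n + 1)).symm k) : ℕ) + 1, (bar π k : ℕ) + 1) := by
    rw [← List.cons_append, last_cons_seqOf, seqOf_append_last]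
    apply List.ext_getElem
    · simp
    · intro k h₁ h₂
      rw [List.length_ofFn] at h₂
      simp only [List.getElem_zip, List.getElem_ofFn]
      rw [List.getElem_append_left (by simpa using h₂), List.getElem_ofFn]
  rw [consecPairs, List.tail_cons, List.mem_toFinset, hzip, List.mem_ofFn]
  constructor
  · rintro ⟨k, rfl⟩
    exact ⟨bar π ((finRotate (n + 1)).symm k), by simp [fmap]⟩
  · rintro ⟨i, rfl⟩
    exact ⟨finRotate (n + 1) ((bar π)⁻¹ i), by simp [fmap]⟩

theorem dH_fmap_le_card_sdiff {n : ℕ} (π σ : Equiv.Perm (Fin n)) :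
    dH (fmap π) (fmap σ) ≤ (consecPairs ((n + 1) :: (seqOf π ++ [n + 1])) \
      consecPairs ((n + 1) :: (seqOf σ ++ [n + 1]))).card := by
  refine Finset.card_le_card_of_injOn
    (fun i : Fin (n + 1) => ((i : ℕ) + 1, (fmap π i : ℕ) + 1)) ?_ ?_
  · intro i hi
    have hne : fmap π i ≠ fmap σ i := by simpa using hi
    rw [Finset.mem_coe, Finset.mem_sdiff, mem_consecPairs_seqOf, mem_consecPairs_seqOf]
    refine ⟨⟨i, rfl⟩, ?_⟩
    rintro ⟨j, hj⟩
    simp only [Prod.mk.injEq, add_left_inj, Fin.val_inj] at hj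
    obtain ⟨rfl, hj⟩ := hj
    exact hne hj
  · intro i _ j _ hij
    simp only [Prod.mk.injEq, add_left_inj, Fin.val_inj] at hij
    exact hij.1

/-- `d_H(f(π̄), f(σ̄)) ≤ 3·d_K̄(π,σ)`. -/
theorem stmt16 (n : ℕ) (π σ : Equiv.Perm (Fin n)) :
    dH (fmap π) (fmap σ) ≤ 3 * genKendallDist (seqOf π) (seqOf σ) := by
  obtain ⟨g, h0, hm, hg⟩ := exists_seq_genKendallDist (seqOf_perm π σ)
  have hcard := card_sdiff_le_of_seq (fun k => consecPairs ((n + 1) :: (g k ++ [n + 1]))) 3 _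
    fun k hk => (hg k hk).card_consecPairs_sdiff_le (n + 1)
  simp only [h0, hm] at hcard
  exact (dH_fmap_le_card_sdiff π σ).trans hcard
end
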